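/- arXiv:1511.07251 — 2 statements merged into one kernel-verified Lean document; each statement's English description precedes it below -/
import Mathlib

section
/- Let A x_k be a sequence of distinct compact A-orbits in X such that every accumulation point of the form x = lim_k a_k x_k with a_k ∈ A lies in A ℤ^d. Then the A-invariant probability measures μ_{A x_k} converge to the zero measure; that is, for every compact set K ⊂ X one has μ_{A x_k}(K) → 0 (equivalently ∫ f dμ_{A x_k} → 0 for every continuous compactly supported f on X). -/
open scoped Pointwise
open MeasureTheory Filter Topology

noncomputable section

abbrev SLR (d : ℕ) := Matrix.SpecialLinearGroup (Fin d) ℝ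

instance (d : ℕ) : TopologicalSpace (SLR d) := instTopologicalSpaceSubtype

def Gamma (d : ℕ) : Subgroup (SLR d) :=
  (Matrix.SpecialLinearGroup.map (n := Fin d) (Int.castRingHom ℝ)).range

abbrev XSpace (d : ℕ) := SLR d ⧸ Gamma d

instance (d : ℕ) : MeasurableSpace (XSpace d) := borel _

def latticeOf (d : ℕ) (x : XSpace d) : Set (Fin d → ℝ) :=
  {w | ∃ g : SLR d, (QuotientGroup.mk g : XSpace d) = x ∧
      ∃ v : Fin d → ℤ, w = (g : Matrix (Fin d) (Fin d) ℝ).mulVec fun i => (v i : ℝ)}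

def shortest (d : ℕ) (x : XSpace d) : ℝ :=
  sInf {r | ∃ w ∈ latticeOf d x, w ≠ 0 ∧ r = ‖w‖}

def aSL (d : ℕ) (t : Fin d → ℝ) (ht : ∑ i, t i = 0) : SLR d :=
  ⟨Matrix.diagonal fun i => Real.exp (t i), by
    rw [Matrix.det_diagonal, ← Real.exp_sum, ht, Real.exp_zero]⟩

def Aorbit (d : ℕ) (x : XSpace d) : Set (XSpace d) :=
  {y | ∃ (t : Fin d → ℝ) (ht : ∑ i, t i = 0), y = aSL d t ht • x}

def stdLat (d : ℕ) : XSpace d := QuotientGroup.mk 1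

instance (d : ℕ) : IsTopologicalGroup (SLR d) :=
  Matrix.SpecialLinearGroup.topologicalGroup

instance (d : ℕ) : BorelSpace (XSpace d) := ⟨rfl⟩

theorem isClosedEmbedding_coe_SLR (d : ℕ) :
    IsClosedEmbedding ((↑) : SLR d → Matrix (Fin d) (Fin d) ℝ) :=
  Matrix.SpecialLinearGroup.isClosedEmbedding_val

instance (d : ℕ) : LocallyCompactSpace (SLR d) :=
  have : LocallyCompactSpace (Matrix (Fin d) (Fin d) ℝ) :=
    inferInstanceAs (LocallyCompactSpace (Fin d → Fin d → ℝ))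
  (isClosedEmbedding_coe_SLR d).locallyCompactSpace

theorem isClosed_Gamma (d : ℕ) : IsClosed (Gamma d : Set (SLR d)) := by
  have h : IsClosedEmbedding (Int.castRingHom ℝ) := Int.isClosedEmbedding_coe_real
  exact (h.specialLinearGroup_map (n := Fin d)).isClosed_range

theorem t2Space_quotient_of_isClosed {G : Type*} [Group G] [TopologicalSpace G]
    [IsTopologicalGroup G] (H : Subgroup G) (hH : IsClosed (H : Set G)) : T2Space (G ⧸ H) := by
  rw [t2Space_iff_of_isOpenQuotientMap (QuotientGroup.isOpenQuotientMap_mk (N := H))]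
  simp only [QuotientGroup.eq]
  exact hH.preimage (f := fun q : G × G => q.1⁻¹ * q.2) (by fun_prop)

instance (d : ℕ) : T2Space (XSpace d) :=
  t2Space_quotient_of_isClosed _ (isClosed_Gamma d)

/-- A compact subset of a quotient of a locally compact group lifts to a compact set. -/
theorem IsCompact.exists_subset_image_quotientGroupMk {G : Type*} [Group G] [TopologicalSpace G]
    [IsTopologicalGroup G] [LocallyCompactSpace G] {H : Subgroup G} {K : Set (G ⧸ H)}
    (hK : IsCompact K) :
    ∃ C : Set G, IsCompact C ∧ K ⊆ (QuotientGroup.mk : G → G ⧸ H) '' C := by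
  refine hK.induction_on (p := fun K => ∃ C : Set G, IsCompact C ∧
    K ⊆ (QuotientGroup.mk : G → G ⧸ H) '' C) ⟨∅, isCompact_empty, by simp⟩ ?_ ?_ ?_
  · rintro s t hst ⟨C, hC, h⟩
    exact ⟨C, hC, hst.trans h⟩
  · rintro s t ⟨C, hC, h⟩ ⟨D, hD, h'⟩
    exact ⟨C ∪ D, hC.union hD, by rw [Set.image_union]; exact Set.union_subset_union h h'⟩
  · intro x _
    obtain ⟨g, rfl⟩ := QuotientGroup.mk_surjective x
    obtain ⟨C, hC, hg⟩ := exists_compact_mem_nhds g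
    exact ⟨_, mem_nhdsWithin_of_mem_nhds
      (QuotientGroup.isOpenQuotientMap_mk.isOpenMap.image_mem_nhds hg), C, hC, subset_rfl⟩

theorem aSL_add {d : ℕ} (s t : Fin d → ℝ) (hs : ∑ i, s i = 0) (ht : ∑ i, t i = 0)
    (hst : ∑ i, (s + t) i = 0) : aSL d (s + t) hst = aSL d s hs * aSL d t ht := by
  refine Subtype.ext ?_
  change Matrix.diagonal _ = Matrix.diagonal _ * Matrix.diagonal _
  simp [Matrix.diagonal_mul_diagonal, Real.exp_add]

/-- The orbit map of the standard lattice under the diagonal group is proper. -/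
theorem IsCompact.exists_norm_le_of_aSL_smul_stdLat_mem {d : ℕ} {K : Set (XSpace d)}
    (hK : IsCompact K) :
    ∃ R : ℝ, ∀ (t : Fin d → ℝ) (ht : ∑ i, t i = 0),
      aSL d t ht • stdLat d ∈ K → ‖t‖ ≤ R := by
  obtain ⟨C, hC, hKC⟩ := hK.exists_subset_image_quotientGroupMk
  have hbd : ∀ j i : Fin d, ∃ M : ℝ, ∀ c ∈ C, |(c⁻¹ : SLR d).1 j i| ≤ M := by
    intro j i
    have hcont : Continuous fun c : SLR d => (c⁻¹ : SLR d).1 j i :=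
      ((isClosedEmbedding_coe_SLR d).continuous.comp
        (continuous_inv (G := SLR d))).matrix_elem j i
    exact hC.exists_bound_of_continuousOn hcont.continuousOn
  choose M hM using hbd
  set M₀ : ℝ := 1 + ∑ j, ∑ i, |M j i| with hM₀
  have hM₀pos : 0 < M₀ := by positivity
  have hMle : ∀ j i, ∀ c ∈ C, |(c⁻¹ : SLR d).1 j i| ≤ M₀ := by
    intro j i c hc
    have h1 : |M j i| ≤ ∑ i, |M j i| :=
      Finset.single_le_sum (f := fun i => |M j i|) (fun _ _ => abs_nonneg _) (Finset.mem_univ i)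
    have h2 : ∑ i, |M j i| ≤ ∑ j, ∑ i, |M j i| :=
      Finset.single_le_sum (f := fun j => ∑ i, |M j i|)
        (fun _ _ => Finset.sum_nonneg fun _ _ => abs_nonneg _) (Finset.mem_univ j)
    linarith [hM j i c hc, le_abs_self (M j i)]
  refine ⟨d * |Real.log M₀|, fun t ht hmem => ?_⟩
  have hlow : ∀ i, -Real.log M₀ ≤ t i := by
    intro i
    obtain ⟨c, hc, hca⟩ := hKC hmem
    have hca' : c⁻¹ * aSL d t ht ∈ Gamma d := by
      have : (QuotientGroup.mk c : XSpace d) = QuotientGroup.mk (aSL d t ht * 1) := hca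
      rwa [QuotientGroup.eq, mul_one] at this
    obtain ⟨γ, hγ⟩ := hca'
    have hγ0 : ∃ j, γ.1 j i ≠ 0 := by
      by_contra! h
      have := Matrix.det_eq_zero_of_column_eq_zero (A := γ.1) i h
      rw [γ.2] at this
      exact one_ne_zero this
    obtain ⟨j, hj⟩ := hγ0
    have hent : ((γ.1 j i : ℤ) : ℝ) = (c⁻¹ : SLR d).1 j i * Real.exp (t i) := by
      have : ((γ.1 j i : ℤ) : ℝ) =
          ((c⁻¹ : SLR d).1 * Matrix.diagonal fun i => Real.exp (t i)) j i :=
        congrArg (fun g : SLR d => g.1 j i) hγ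
      rwa [Matrix.mul_diagonal] at this
    have h1 : (1 : ℝ) ≤ |((γ.1 j i : ℤ) : ℝ)| := by
      exact_mod_cast Int.one_le_abs hj
    rw [hent, abs_mul, Real.abs_exp] at h1
    have h2 : 1 ≤ M₀ * Real.exp (t i) :=
      h1.trans (mul_le_mul_of_nonneg_right (hMle j i c hc) (Real.exp_pos _).le)
    have h3 := Real.log_le_log one_pos h2
    rw [Real.log_one, Real.log_mul hM₀pos.ne' (Real.exp_pos _).ne', Real.log_exp] at h3
    linarith
  refine (pi_norm_le_iff_of_nonneg (by positivity)).2 fun i => ?_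
  have hd : (1 : ℝ) ≤ d := by exact_mod_cast i.pos
  have hle : ∀ i, -|Real.log M₀| ≤ t i := fun i =>
    (neg_le_neg (le_abs_self _)).trans (hlow i)
  rw [Real.norm_eq_abs, abs_le]
  constructor
  · nlinarith [hle i, abs_nonneg (Real.log M₀)]
  · have h := Finset.add_sum_erase Finset.univ t (Finset.mem_univ i)
    have h' : ∑ _j ∈ Finset.univ.erase i, (-|Real.log M₀|) ≤ ∑ j ∈ Finset.univ.erase i, t j :=
      Finset.sum_le_sum fun j _ => hle j
    rw [Finset.sum_const, Finset.card_erase_of_mem (Finset.mem_univ i), Finset.card_univ,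
      Fintype.card_fin, nsmul_eq_mul, Nat.cast_sub i.pos] at h'
    push_cast at h'
    nlinarith [abs_nonneg (Real.log M₀)]

theorem isCompact_aSL_smul_stdLat_norm_le (d : ℕ) (R : ℝ) :
    IsCompact {y | ∃ (t : Fin d → ℝ) (ht : ∑ i, t i = 0),
      ‖t‖ ≤ R ∧ y = aSL d t ht • stdLat d} := by
  let f : {t : Fin d → ℝ // ∑ i, t i = 0} → XSpace d :=
    fun t => QuotientGroup.mk (aSL d t.1 t.2)
  have hf : Continuous f := by
    refine continuous_quotient_mk'.comp (Continuous.subtype_mk ?_ _)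
    exact Continuous.matrix_diagonal (continuous_pi fun i =>
      Real.continuous_exp.comp ((continuous_apply i).comp continuous_subtype_val))
  have hcl : IsClosed {t : Fin d → ℝ | ∑ i, t i = 0} :=
    isClosed_eq (by fun_prop) continuous_const
  have hB : IsCompact (Subtype.val ⁻¹' Metric.closedBall 0 R : Set {t : Fin d → ℝ // ∑ i, t i = 0}) :=
    hcl.isClosedEmbedding_subtypeVal.isCompact_preimage (isCompact_closedBall 0 R)
  convert hB.image hf using 1
  ext y
  constructor
  · rintro ⟨t, ht, hR, rfl⟩
    exact ⟨⟨t, ht⟩, by simpa using hR, congrArg QuotientGroup.mk (mul_one _).symm⟩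
  · rintro ⟨⟨t, ht⟩, hR, rfl⟩
    exact ⟨t, ht, by simpa using hR, congrArg QuotientGroup.mk (mul_one _).symm⟩

/-- Finitely many pairwise disjoint compact sets in a Hausdorff space have pairwise disjoint
open neighbourhoods. -/
theorem exists_pairwise_disjoint_open_of_isCompact {ι X : Type*} [Finite ι] [TopologicalSpace X]
    [T2Space X] {s : ι → Set X} (hs : ∀ i, IsCompact (s i))
    (hd : Pairwise fun i j => Disjoint (s i) (s j)) :
    ∃ V : ι → Set X, (∀ i, IsOpen (V i)) ∧ (∀ i, s i ⊆ V i) ∧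
      Pairwise fun i j => Disjoint (V i) (V j) := by
  have h : ∀ i j, ∃ P Q : Set X, i ≠ j →
      IsOpen P ∧ IsOpen Q ∧ s i ⊆ P ∧ s j ⊆ Q ∧ Disjoint P Q := by
    intro i j
    by_cases hij : i = j
    · exact ⟨∅, ∅, fun h => absurd hij h⟩
    · obtain ⟨P, Q, h⟩ := SeparatedNhds.of_isCompact_isCompact (hs i) (hs j) (hd hij)
      exact ⟨P, Q, fun _ => h⟩
  choose P Q h using h
  refine ⟨fun i => ⋂ j, ⋂ (_ : i ≠ j), P i j ∩ Q j i, fun i => ?_, fun i => ?_, ?_⟩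
  · exact isOpen_iInter_of_finite fun j => isOpen_iInter_of_finite fun hij =>
      (h i j hij).1.inter (h j i hij.symm).2.1
  · exact Set.subset_iInter₂ fun j hij =>
      Set.subset_inter (h i j hij).2.2.1 (h j i hij.symm).2.2.2.1
  · intro i j hij
    exact (h i j hij).2.2.2.2.mono
      ((Set.iInter₂_subset j hij).trans Set.inter_subset_left)
      ((Set.iInter₂_subset i hij.symm).trans Set.inter_subset_right)

/-- The part of the orbit of the standard lattice lying in a compact set has an open
neighbourhood of small measure for every invariant probability measure. -/
theorem exists_open_measure_le_of_isCompact {d : ℕ} (hd : 2 ≤ d) {K : Set (XSpace d)}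
    (hK : IsCompact K) (n : ℕ) :
    ∃ U : Set (XSpace d), IsOpen U ∧ K ∩ Aorbit d (stdLat d) ⊆ U ∧
      ∀ μ : Measure (XSpace d), IsProbabilityMeasure μ →
        (∀ (t : Fin d → ℝ) (ht : ∑ i, t i = 0), Measure.map (fun y => aSL d t ht • y) μ = μ) →
        n * μ U ≤ 1 := by
  obtain ⟨R, hR⟩ := hK.exists_norm_le_of_aSL_smul_stdLat_mem
  set D := {y | ∃ (t : Fin d → ℝ) (ht : ∑ i, t i = 0), ‖t‖ ≤ R ∧ y = aSL d t ht • stdLat d}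
  have hDc : IsCompact D := isCompact_aSL_smul_stdLat_norm_le d R
  obtain ⟨R', hR'⟩ := hDc.exists_norm_le_of_aSL_smul_stdLat_mem
  let p : Fin d := ⟨0, by omega⟩
  let q : Fin d := ⟨1, by omega⟩
  have hpq : p ≠ q := by simp [p, q]
  let v : Fin d → ℝ := Pi.single p (|R| + |R'| + 1) - Pi.single q (|R| + |R'| + 1)
  have hv0 : ∑ i, v i = 0 := by simp [v]
  have hvp : v p = |R| + |R'| + 1 := by simp [v, hpq]
  have hs : ∀ r : ℝ, ∑ i, (r • v) i = 0 := by
    intro r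
    simp [← Finset.mul_sum, hv0]
  let f : Fin n → XSpace d → XSpace d := fun j y => aSL d ((j : ℝ) • v) (hs j) • y
  have hf : ∀ j, Continuous (f j) := fun j => continuous_const_smul _
  have hdisj : Pairwise fun i j => Disjoint (f i '' D) (f j '' D) := by
    intro i j hij
    rw [Set.disjoint_left]
    rintro _ ⟨_, ⟨t, ht, htR, rfl⟩, rfl⟩ ⟨_, ⟨t', ht', htR', rfl⟩, he⟩
    have hsum : ∑ k, (((j : ℝ) - i) • v + t') k = 0 := by
      simp only [Pi.add_apply, Finset.sum_add_distrib, hs, ht', add_zero]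
    have hsum' : ∑ k, ((i : ℝ) • v + (((j : ℝ) - i) • v + t')) k = 0 := by
      simp only [Pi.add_apply] at hsum
      simp only [Pi.add_apply, Finset.sum_add_distrib (f := ((i : ℝ) • v)), hs, hsum, add_zero]
    have hmem : aSL d (((j : ℝ) - i) • v + t') hsum • stdLat d ∈ D := by
      refine ⟨t, ht, htR, ?_⟩
      apply smul_left_cancel (aSL d ((i : ℝ) • v) (hs i))
      refine Eq.trans ?_ he
      change _ = aSL d ((j : ℝ) • v) (hs j) • aSL d t' ht' • stdLat d
      rw [← mul_smul, ← mul_smul, ← aSL_add _ _ _ _ hsum',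
        ← aSL_add _ _ _ _ (by simp only [Pi.add_apply, Finset.sum_add_distrib, hs, ht', add_zero])]
      congr 2
      module
    have h1 := (norm_le_pi_norm _ p).trans (hR' _ hsum hmem)
    have h2 := (norm_le_pi_norm _ p).trans htR'
    simp only [Pi.add_apply, Pi.smul_apply, smul_eq_mul, hvp, Real.norm_eq_abs] at h1 h2
    have h3 : (1 : ℝ) ≤ |(j : ℝ) - i| := by
      have : (1 : ℤ) ≤ |((j : ℕ) : ℤ) - (i : ℕ)| := by
        apply Int.one_le_abs
        have := Fin.val_ne_of_ne hij
        omega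
      exact_mod_cast this
    have h4 : |((j : ℝ) - i) * (|R| + |R'| + 1)| ≤ R' + R := by
      have := abs_sub (((j : ℝ) - i) * (|R| + |R'| + 1) + t' p) (t' p)
      rw [add_sub_cancel_right] at this
      linarith
    rw [abs_mul, abs_of_pos (by positivity : (0 : ℝ) < |R| + |R'| + 1)] at h4
    nlinarith [le_abs_self R, le_abs_self R', abs_nonneg R, abs_nonneg R']
  obtain ⟨V, hVo, hDV, hVd⟩ :=
    exists_pairwise_disjoint_open_of_isCompact (fun j => hDc.image (hf j)) hdisj
  refine ⟨⋂ j, f j ⁻¹' V j, isOpen_iInter_of_finite fun j => (hVo j).preimage (hf j), ?_, ?_⟩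
  · rintro y ⟨hyK, t, ht, rfl⟩
    exact Set.mem_iInter.2 fun j => hDV j ⟨_, ⟨t, ht, hR t ht hyK, rfl⟩, rfl⟩
  · intro μ hμ hinv
    have hle : ∀ j, μ (⋂ j, f j ⁻¹' V j) ≤ μ (V j) := by
      intro j
      calc μ (⋂ j, f j ⁻¹' V j) ≤ μ (f j ⁻¹' V j) := measure_mono (Set.iInter_subset _ j)
        _ = Measure.map (f j) μ (V j) :=
          (Measure.map_apply (hf j).measurable (hVo j).measurableSet).symm
        _ = μ (V j) := by rw [hinv]
    calc n * μ (⋂ j, f j ⁻¹' V j) = ∑ _j : Fin n, μ (⋂ j, f j ⁻¹' V j) := by simp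
      _ ≤ ∑ j, μ (V j) := Finset.sum_le_sum fun j _ => hle j
      _ ≤ μ Set.univ := sum_measure_le_measure_univ
          (fun j _ => (hVo j).measurableSet.nullMeasurableSet)
          (fun i _ j _ hij => (hVd hij).aedisjoint)
      _ = 1 := measure_univ

theorem stmt1 (d : ℕ) (hd : 2 ≤ d) (x : ℕ → XSpace d)
    (hcpt : ∀ k, IsCompact (Aorbit d (x k)))
    (hdist : ∀ k l, k ≠ l → Aorbit d (x k) ≠ Aorbit d (x l))
    (hacc : ∀ (t : ℕ → Fin d → ℝ) (ht : ∀ k, ∑ i, t k i = 0) (y : XSpace d),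
        MapClusterPt y Filter.atTop (fun k => aSL d (t k) (ht k) • x k) →
        y ∈ Aorbit d (stdLat d))
    (μ : ℕ → Measure (XSpace d))
    (hprob : ∀ k, IsProbabilityMeasure (μ k))
    (hsupp : ∀ k, μ k ((Aorbit d (x k))ᶜ) = 0)
    (hinv : ∀ k (t : Fin d → ℝ) (ht : ∑ i, t i = 0),
        Measure.map (fun y => aSL d t ht • y) (μ k) = μ k) :
    ∀ K : Set (XSpace d), IsCompact K →
      Tendsto (fun k => μ k K) atTop (𝓝 0) := by
  intro K hK
  rw [ENNReal.tendsto_nhds_zero]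
  intro ε hε
  obtain ⟨n, hn⟩ := ENNReal.exists_inv_nat_lt hε.ne'
  obtain ⟨U, hUo, hKU, hU⟩ := exists_open_measure_le_of_isCompact hd hK n
  have hev : ∀ᶠ k in atTop, K ∩ Aorbit d (x k) ⊆ U := by
    by_contra hne
    have hex : ∀ k, ∃ (t : Fin d → ℝ) (ht : ∑ i, t i = 0),
        ¬ K ∩ Aorbit d (x k) ⊆ U → aSL d t ht • x k ∈ K \ U := by
      intro k
      by_cases h : K ∩ Aorbit d (x k) ⊆ U
      · exact ⟨0, by simp, fun h' => absurd h h'⟩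
      · obtain ⟨y, ⟨hyK, t, ht, rfl⟩, hyU⟩ := Set.not_subset.1 h
        exact ⟨t, ht, fun _ => ⟨hyK, hyU⟩⟩
    choose t ht hmem using hex
    obtain ⟨y, hy, hcl⟩ := (hK.diff hUo).exists_mapClusterPt_of_frequently
      ((not_eventually.1 hne).mono hmem)
    exact hy.2 (hKU ⟨hy.1, hacc t ht y hcl⟩)
  filter_upwards [hev] with k hk
  have hKle : μ k K ≤ μ k U := by
    calc μ k K ≤ μ k (U ∪ (Aorbit d (x k))ᶜ) := measure_mono fun y hy => by
          by_cases h : y ∈ Aorbit d (x k)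
          · exact Or.inl (hk ⟨hy, h⟩)
          · exact Or.inr h
      _ ≤ μ k U + μ k (Aorbit d (x k))ᶜ := measure_union_le _ _
      _ = μ k U := by rw [hsupp, add_zero]
  refine (hKle.trans ?_).trans hn.le
  rw [ENNReal.le_inv_iff_mul_le, mul_comm]
  exact hU (μ k) (hprob k) (hinv k)
end
end

section
/- Fix M > 1 and κ ∈ (0,1). Let x ∈ Ω_M with M-tight simplex set Φ, and assume ρ = |Δ_x|^{κ/n}/ξ_Φ < 1. Then, with δ = M e^{−(n/2)|Δ_x|^{κ/n}} and r = c|Δ_x|^{κ/n} (c the universal covering constant), the set of times {t ∈ ℝ^d_0 : ℓ(a(t)x) > δ} is contained in W'_Φ + B_r + Δ_Φ. -/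
open scoped Pointwise

noncomputable section

/-- The hyperplane `ℝ^d_0` of zero coordinate sum, as a set. -/
def V0 (d : ℕ) : Set (Fin d → ℝ) := {t | ∑ i, t i = 0}

/-- The hyperplane `ℝ^d_0`, as a submodule. -/
def V0sub (d : ℕ) : Submodule ℝ (Fin d → ℝ) :=
  LinearMap.ker (∑ i : Fin d, LinearMap.proj i)

/-- A simplex set: `d` vectors in `ℝ^d_0` summing to zero and spanning `ℝ^d_0`. -/
structure SimplexSet (d : ℕ) where
  elems : Finset (Fin d → ℝ)
  card_eq : elems.card = d
  sum_eq_zero : elems.sum id = 0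
  span_eq : Submodule.span ℝ (elems : Set (Fin d → ℝ)) = V0sub d

/-- The lattice `Δ_Φ` associated to a simplex set. -/
def latticeOfSS {d : ℕ} (Φ : SimplexSet d) : AddSubgroup (Fin d → ℝ) :=
  AddSubgroup.closure (Φ.elems : Set (Fin d → ℝ))

/-- `⌈t⌉ = max_i t_i`. -/
def ceilMax {d : ℕ} (t : Fin d → ℝ) : ℝ := ⨆ i, t i

/-- `ξ_Φ = max_{t ∈ Φ} ⌈t⌉`. -/
def xi {d : ℕ} (Φ : SimplexSet d) : ℝ :=
  sSup (ceilMax '' (Φ.elems : Set (Fin d → ℝ)))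

/-- Square root of the absolute Gram determinant of a `(d-1)`-tuple of vectors. -/
def gram (d : ℕ) (v : Fin (d - 1) → (Fin d → ℝ)) : ℝ :=
  Real.sqrt |(Matrix.of fun i j : Fin (d - 1) => ∑ k, v i k * v j k).det|

/-- The (euclidean) covolume of the lattice generated by a set `S ⊆ ℝ^d_0` of rank `d-1`:
the common value of the Gram determinant over all `(d-1)`-tuples generating the same
subgroup as `S`. -/
def covolSet (d : ℕ) (S : Set (Fin d → ℝ)) : ℝ :=
  sInf {r | ∃ v : Fin (d - 1) → (Fin d → ℝ),
      AddSubgroup.closure (Set.range v) = AddSubgroup.closure S ∧ r = gram d v}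

/-- The covolume `|Δ_Φ|`. -/
def covolSS {d : ℕ} (Φ : SimplexSet d) : ℝ := covolSet d (Φ.elems : Set (Fin d → ℝ))

/-- The set `φ(stab_{UA}(x))` of logarithmic stabilizer times. -/
def stabSet (d : ℕ) (x : XSpace d) : Set (Fin d → ℝ) :=
  {t | (∑ i, t i = 0) ∧ ∃ ε : Fin d → ℝ, (∀ i, ε i = 1 ∨ ε i = -1) ∧
      (fun v => (Matrix.diagonal fun i => ε i * Real.exp (t i)).mulVec v) '' latticeOf d x
        = latticeOf d x}

/-- The lattice `Δ_x = φ(stab_{UA}(x))`. -/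
def DeltaX (d : ℕ) (x : XSpace d) : AddSubgroup (Fin d → ℝ) :=
  AddSubgroup.closure (stabSet d x)

/-- The covolume `|Δ_x|`. -/
def covolX (d : ℕ) (x : XSpace d) : ℝ := covolSet d (stabSet d x)

/-- `Φ` is an `M`-tight simplex set for `x`. -/
def IsTight (d : ℕ) (M : ℝ) (x : XSpace d) (Φ : SimplexSet d) : Prop :=
  (Φ.elems : Set (Fin d → ℝ)) ⊆ (DeltaX d x : Set (Fin d → ℝ)) ∧
  shortest d x ≤ M * Real.exp (-((d - 1 : ℝ) / 2) * xi Φ)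

/-- `Ω_M`: points of `Ω` admitting an `M`-tight simplex set. -/
def OmegaM (d : ℕ) (M : ℝ) : Set (XSpace d) :=
  {x | IsCompact (Aorbit d x) ∧ ∃ Φ : SimplexSet d, IsTight d M x Φ}

/-- The standard simplex set vectors `b_j` (with `-(d-1)` in coordinate `j`, `1` elsewhere). -/
def bstar (d : ℕ) (j : Fin d) : Fin d → ℝ := fun i => if i = j then -(d - 1 : ℝ) else 1

/-- The points `w_τ^{Φ_*} = τ(d⁻¹ ∑_ℓ (ℓ-1) b_ℓ)`. -/
def wStar (d : ℕ) (τ : Equiv.Perm (Fin d)) : Fin d → ℝ :=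
  fun i => (d : ℝ)⁻¹ * ∑ ℓ : Fin d, (ℓ : ℝ) * bstar d ℓ (τ.symm i)

/-- `h` is a distortion map for `Φ`: a linear map with `h Φ_* = |Δ_Φ|^{-1/(d-1)} Φ`. -/
def IsDistortion {d : ℕ} (Φ : SimplexSet d) (h : (Fin d → ℝ) →ₗ[ℝ] (Fin d → ℝ)) : Prop :=
  h '' Set.range (bstar d) =
    (fun v => (covolSS Φ) ^ (-(1 : ℝ) / (d - 1 : ℝ)) • v) '' (Φ.elems : Set (Fin d → ℝ))

/-- `w_τ^Φ = |Δ_Φ|^{1/(d-1)} h_Φ (w_τ^{Φ_*})`. -/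
def wPhi {d : ℕ} (Φ : SimplexSet d) (h : (Fin d → ℝ) →ₗ[ℝ] (Fin d → ℝ))
    (τ : Equiv.Perm (Fin d)) : Fin d → ℝ :=
  (covolSS Φ) ^ ((1 : ℝ) / (d - 1 : ℝ)) • h (wStar d τ)

/-- `S'` is a set of representatives for the cosets `𝒮 / ⟨θ⟩`, `θ` the cyclic rotation. -/
def IsRepSet (d : ℕ) (S' : Set (Equiv.Perm (Fin d))) : Prop :=
  ∀ τ : Equiv.Perm (Fin d), ∃! σ, σ ∈ S' ∧ τ⁻¹ * σ ∈ Subgroup.zpowers (finRotate d)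

/-- The closed ball of radius `r` in `ℝ^d_0`. -/
def ballV0 (d : ℕ) (r : ℝ) : Set (Fin d → ℝ) := {t | (∑ i, t i = 0) ∧ ‖t‖ ≤ r}

/-- Operator norm of a matrix with respect to the supremum norm. -/
def opNorm (d : ℕ) (g : Matrix (Fin d) (Fin d) ℝ) : ℝ :=
  sSup {r | ∃ v : Fin d → ℝ, ‖v‖ ≤ 1 ∧ r = ‖g.mulVec v‖}

/-- Operator norm of a linear map restricted to the hyperplane `ℝ^d_0`. -/
def normOnV0 (d : ℕ) (h : (Fin d → ℝ) →ₗ[ℝ] (Fin d → ℝ)) : ℝ :=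
  sSup {r | ∃ v : Fin d → ℝ, (∑ i, v i = 0) ∧ ‖v‖ ≤ 1 ∧ r = ‖h v‖}

/-- `Ω_M(ε, C)`. -/
def OmegaMEC (d : ℕ) (M ε C : ℝ) : Set (XSpace d) :=
  {x | IsCompact (Aorbit d x) ∧ ∃ Φ : SimplexSet d, IsTight d M x Φ ∧
    ∃ h, IsDistortion Φ h ∧
      ∀ τ : Equiv.Perm (Fin d), ∃ (hw : ∑ i, wPhi Φ h τ i = 0)
        (g : SLR d) (s : Fin d → ℝ) (hs : ∑ i, s i = 0),
        opNorm d ((g : Matrix (Fin d) (Fin d) ℝ) - 1) ≤ C * Real.exp (-(covolX d x) ^ ε) ∧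
        aSL d (wPhi Φ h τ) hw • x = (g * aSL d s hs) • stdLat d}

/-- Homothety–`GL(ℤ)` equivalence of `(d-1)`-tuples: same lattice shape. -/
def shapeRel (d : ℕ) (v w : Fin (d - 1) → (Fin d → ℝ)) : Prop :=
  ∃ c : ℝ, 0 < c ∧ ∃ g : Matrix (Fin (d - 1)) (Fin (d - 1)) ℤ, IsUnit g.det ∧
    ∀ i, w i = c • ∑ j, ((g i j : ℝ) • v j)

/-- The space of shapes of lattices in `ℝ^d_0` (with the quotient topology). -/
def ShapeSpace (d : ℕ) := Quot (shapeRel d)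

instance (d : ℕ) : TopologicalSpace (ShapeSpace d) :=
  instTopologicalSpaceQuot

/-- The shape of the lattice generated by a tuple. -/
def shapeOf (d : ℕ) (v : Fin (d - 1) → (Fin d → ℝ)) : ShapeSpace d := Quot.mk _ v

/-- An enumeration of the elements of a simplex set. -/
def ssEnum {d : ℕ} (Φ : SimplexSet d) : Fin d → (Fin d → ℝ) :=
  fun i => ((Φ.elems.equivFin.symm (finCongr Φ.card_eq.symm i)) : Fin d → ℝ)

/-- The shape of `Δ_Φ` (generated by the first `d-1` elements of `Φ`). -/
def shapeOfSS {d : ℕ} (Φ : SimplexSet d) : ShapeSpace d :=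
  shapeOf d fun i : Fin (d - 1) => ssEnum Φ (Fin.castLE (Nat.sub_le d 1) i)

/-- `Ω_{M,K}`. -/
def OmegaMK (d : ℕ) (M : ℝ) (K : Set (ShapeSpace d)) : Set (XSpace d) :=
  {x | IsCompact (Aorbit d x) ∧ ∃ Φ : SimplexSet d, IsTight d M x Φ ∧ shapeOfSS Φ ∈ K}

/-- The image under `k` of a vector of the lattice of `x` lies in the lattice of `k • x`. -/
lemma mulVec_mem_latticeOf_smul {d : ℕ} (k : SLR d) {x : XSpace d} {w : Fin d → ℝ}
    (hw : w ∈ latticeOf d x) :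
    (k : Matrix (Fin d) (Fin d) ℝ).mulVec w ∈ latticeOf d (k • x) := by
  obtain ⟨g, rfl, v, rfl⟩ := hw
  refine ⟨k * g, rfl, v, ?_⟩
  rw [Matrix.mulVec_mulVec, Matrix.SpecialLinearGroup.coe_mul]

lemma shortest_le_norm {d : ℕ} {x : XSpace d} {w : Fin d → ℝ} (hw : w ∈ latticeOf d x)
    (hw0 : w ≠ 0) : shortest d x ≤ ‖w‖ :=
  csInf_le ⟨0, by rintro _ ⟨w, -, -, rfl⟩; exact norm_nonneg w⟩ ⟨w, hw, hw0, rfl⟩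

/-- Minkowski's first theorem for the supremum norm: a unimodular lattice has a nonzero vector
of norm at most one. -/
lemma exists_latticeOf_norm_le_one {d : ℕ} (hd : 0 < d) (x : XSpace d) :
    ∃ w ∈ latticeOf d x, w ≠ 0 ∧ ‖w‖ ≤ 1 := by
  have : Nonempty (Fin d) := ⟨⟨0, hd⟩⟩
  obtain ⟨g, rfl⟩ := QuotientGroup.mk_surjective x
  set A : Matrix (Fin d) (Fin d) ℝ := (g : Matrix (Fin d) (Fin d) ℝ)
  have hA : A.det = 1 := g.2
  have hAu : IsUnit A := by rw [Matrix.isUnit_iff_isUnit_det, hA]; exact isUnit_one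
  have hli : LinearIndependent ℝ A.col := Matrix.linearIndependent_cols_iff_isUnit.2 hAu
  let b : Module.Basis (Fin d) ℝ (Fin d → ℝ) :=
    basisOfLinearIndependentOfCardEqFinrank hli (by simp)
  have hb : ⇑b = A.col := coe_basisOfLinearIndependentOfCardEqFinrank hli (by simp)
  let L := (Submodule.span ℤ (Set.range b)).toAddSubgroup
  have hvol : MeasureTheory.volume (ZSpan.fundamentalDomain b) = 1 := by
    rw [ZSpan.volume_fundamentalDomain, hb]
    have : (Matrix.of A.col) = A.transpose := rfl
    rw [this, Matrix.det_transpose, hA]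
    simp
  have hball : MeasureTheory.volume (Metric.closedBall (0 : Fin d → ℝ) 1) = 2 ^ d := by
    rw [Real.volume_pi_closedBall _ zero_le_one]
    simp
  have : Countable L := inferInstanceAs (Countable (Submodule.span ℤ (Set.range b)))
  have : DiscreteTopology L :=
    inferInstanceAs (DiscreteTopology (Submodule.span ℤ (Set.range b)))
  obtain ⟨⟨w, hwL⟩, hw0, hw1⟩ :=
    MeasureTheory.exists_ne_zero_mem_lattice_of_measure_mul_two_pow_le_measure
      (L := L) (ZSpan.isAddFundamentalDomain' b MeasureTheory.volume)
      (s := Metric.closedBall (0 : Fin d → ℝ) 1)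
      (fun y hy => by simpa using hy) (convex_closedBall 0 1) (isCompact_closedBall 0 1)
      (by rw [hvol, hball]; simp)
  refine ⟨w, ⟨g, rfl, ?_⟩, fun h => hw0 (Subtype.ext h), by simpa using hw1⟩
  obtain ⟨v, hv⟩ := (Submodule.mem_span_range_iff_exists_fun ℤ).1 hwL
  refine ⟨v, ?_⟩
  rw [← hv, hb]
  ext i
  simp [Matrix.mulVec, dotProduct, Matrix.col, Finset.sum_apply, mul_comm, A]

lemma shortest_le_one {d : ℕ} (hd : 0 < d) (x : XSpace d) : shortest d x ≤ 1 := by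
  obtain ⟨w, hw, hw0, hw1⟩ := exists_latticeOf_norm_le_one hd x
  exact (shortest_le_norm hw hw0).trans hw1

/-- The logarithmic stabilizer times form a subgroup. -/
lemma mem_stabSet_of_mem_DeltaX {d : ℕ} {x : XSpace d} {t : Fin d → ℝ}
    (ht : t ∈ DeltaX d x) : t ∈ stabSet d x := by
  induction ht using AddSubgroup.closure_induction with
  | mem t ht => exact ht
  | zero => exact ⟨by simp, fun _ => 1, by simp, by simp⟩
  | add s t _ _ hs ht =>
    obtain ⟨hs0, ε, hε, hεL⟩ := hs
    obtain ⟨ht0, η, hη, hηL⟩ := ht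
    refine ⟨by simp [Finset.sum_add_distrib, hs0, ht0], fun i => ε i * η i, fun i => ?_, ?_⟩
    · rcases hε i with h | h <;> rcases hη i with h' | h' <;> simp [h, h']
    · conv_rhs => rw [← hεL, ← hηL, Set.image_image]
      refine Set.image_congr fun v _ => ?_
      rw [Matrix.mulVec_mulVec, Matrix.diagonal_mul_diagonal]
      congr 2
      ext i
      simp only [Pi.add_apply, Real.exp_add]
      ring
  | neg t _ ht =>
    obtain ⟨ht0, ε, hε, hεL⟩ := ht
    refine ⟨by simp [ht0], ε, hε, ?_⟩
    conv_lhs => rw [← hεL, Set.image_image]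
    conv_rhs => rw [← Set.image_id (latticeOf d x)]
    refine Set.image_congr fun v _ => ?_
    rw [Matrix.mulVec_mulVec, Matrix.diagonal_mul_diagonal]
    have : (fun i => ε i * Real.exp ((-t) i) * (ε i * Real.exp (t i))) = fun _ => (1 : ℝ) := by
      ext i
      have hεε : ε i * ε i = 1 := by rcases hε i with h | h <;> simp [h]
      rw [Pi.neg_apply, mul_mul_mul_comm, hεε, ← Real.exp_add]
      simp
    rw [this]
    simp

/-- If `t` differs from `s` by a stabilizer time, and all coordinates of `s` are at most `C`, then
flowing `x` for time `t` expands the shortest vector by a factor of at most `exp C`. -/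
lemma shortest_aSL_smul_le {d : ℕ} (hd : 0 < d) {x : XSpace d} {s v t : Fin d → ℝ} {C : ℝ}
    (hs : ∀ i, s i ≤ C) (hv : v ∈ stabSet d x) (hsv : s + v = t) (ht : ∑ i, t i = 0) :
    shortest d (aSL d t ht • x) ≤ Real.exp C * shortest d x := by
  obtain ⟨-, ε, hε, hL⟩ := hv
  rw [← div_le_iff₀' (Real.exp_pos C)]
  refine le_csInf ?_ ?_
  · obtain ⟨w, hw, hw0, -⟩ := exists_latticeOf_norm_le_one hd x
    exact ⟨_, w, hw, hw0, rfl⟩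
  rintro _ ⟨w, hw, hw0, rfl⟩
  rw [div_le_iff₀' (Real.exp_pos C)]
  rw [← hL] at hw
  obtain ⟨u, hu, rfl⟩ := hw
  have hu0 : u ≠ 0 := by
    rintro rfl
    exact hw0 (Matrix.mulVec_zero _)
  have hcoord (i : Fin d) :
      (aSL d t ht : Matrix (Fin d) (Fin d) ℝ).mulVec u i = Real.exp (t i) * u i :=
    Matrix.mulVec_diagonal _ _ _
  refine (shortest_le_norm (mulVec_mem_latticeOf_smul _ hu) fun h0 => hu0 ?_).trans ?_
  · ext i
    have := congrFun h0 i
    rw [hcoord] at this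
    simpa [Real.exp_ne_zero] using this
  refine (pi_norm_le_iff_of_nonneg (by positivity)).2 fun i => ?_
  refine le_trans ?_ (mul_le_mul_of_nonneg_left (norm_le_pi_norm _ i) (Real.exp_pos C).le)
  have hεi : |ε i| = 1 := by rcases hε i with h | h <;> simp [h]
  beta_reduce
  rw [hcoord, Matrix.mulVec_diagonal, ← hsv, Pi.add_apply, Real.exp_add]
  simp only [Real.norm_eq_abs, abs_mul, Real.abs_exp, hεi, one_mul]
  rw [mul_assoc]
  gcongr
  exact hs i

lemma coord_le_xi {d : ℕ} (Φ : SimplexSet d) {y : Fin d → ℝ} (hy : y ∈ Φ.elems) (i : Fin d) :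
    y i ≤ xi Φ :=
  (le_ciSup (Set.finite_range y).bddAbove i).trans
    (le_csSup (Φ.elems.finite_toSet.image _).bddAbove (Set.mem_image_of_mem _ hy))

lemma coord_le_xi_of_mem_convexHull {d : ℕ} (Φ : SimplexSet d) {y : Fin d → ℝ}
    (hy : y ∈ convexHull ℝ (Φ.elems : Set (Fin d → ℝ))) (i : Fin d) : y i ≤ xi Φ :=
  convexHull_min (t := {z : Fin d → ℝ | z i ≤ xi Φ}) (fun _ hz => coord_le_xi Φ hz i)
    (convex_halfSpace_le (LinearMap.proj (R := ℝ) (φ := fun _ : Fin d => ℝ) i).isLinear _) hy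

lemma sum_eq_zero_of_mem_simplexSet {d : ℕ} (Φ : SimplexSet d) {y : Fin d → ℝ}
    (hy : y ∈ Φ.elems) : ∑ i, y i = 0 := by
  have : y ∈ V0sub d := by
    rw [← Φ.span_eq]
    exact Submodule.subset_span hy
  simpa [V0sub] using this

lemma xi_pos {d : ℕ} (hd : 2 ≤ d) (Φ : SimplexSet d) : 0 < xi Φ := by
  obtain ⟨y, hy, hy0⟩ : ∃ y ∈ Φ.elems, y ≠ 0 :=
    Finset.exists_mem_ne (by rw [Φ.card_eq]; omega) 0
  by_contra! hxi
  have hle (i : Fin d) : y i ≤ 0 := (coord_le_xi Φ hy i).trans hxi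
  refine hy0 (funext fun i => ?_)
  exact (Finset.sum_eq_zero_iff_of_nonpos fun i _ => hle i).1
    (sum_eq_zero_of_mem_simplexSet Φ hy) i (Finset.mem_univ i)

lemma covolSet_nonneg (d : ℕ) (S : Set (Fin d → ℝ)) : 0 ≤ covolSet d S :=
  Real.sInf_nonneg fun _ ⟨_, _, hr⟩ => hr ▸ Real.sqrt_nonneg _

theorem stmt5 (d : ℕ) (hd : 2 ≤ d) (M κ : ℝ) (hM : 1 < M) (hκ0 : 0 < κ) (hκ1 : κ < 1)
    (c : ℝ) (hc : 0 < c)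
    (hcovering : ∀ (Ψ : SimplexSet d) (h : (Fin d → ℝ) →ₗ[ℝ] (Fin d → ℝ)),
      IsDistortion Ψ h → ∀ S' : Set (Equiv.Perm (Fin d)), IsRepSet d S' →
        ∀ ρ : ℝ, 0 < ρ → ρ < 1 →
          V0 d \ (((1 - ρ) * ((d - 1 : ℝ) / 2)) • convexHull ℝ (Ψ.elems : Set (Fin d → ℝ)) +
              (latticeOfSS Ψ : Set (Fin d → ℝ))) ⊆
            wPhi Ψ h '' S' + ballV0 d (c * ρ * xi Ψ) + (latticeOfSS Ψ : Set (Fin d → ℝ)))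
    (x : XSpace d) (hx : IsCompact (Aorbit d x)) (Φ : SimplexSet d)
    (hΦ : IsTight d M x Φ)
    (hρ : (covolX d x) ^ (κ / (d - 1 : ℝ)) / xi Φ < 1)
    (h : (Fin d → ℝ) →ₗ[ℝ] (Fin d → ℝ)) (hh : IsDistortion Φ h)
    (S' : Set (Equiv.Perm (Fin d))) (hS' : IsRepSet d S') :
    {t : Fin d → ℝ | ∃ ht : ∑ i, t i = 0,
        M * Real.exp (-((d - 1 : ℝ) / 2) * (covolX d x) ^ (κ / (d - 1 : ℝ))) <
          shortest d (aSL d t ht • x)} ⊆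
      wPhi Φ h '' S' + ballV0 d (c * (covolX d x) ^ (κ / (d - 1 : ℝ))) +
        (latticeOfSS Φ : Set (Fin d → ℝ)) := by
  rintro t ⟨ht, hlt⟩
  have hd0 : 0 < d := by omega
  have hn : (0 : ℝ) ≤ (d - 1 : ℝ) / 2 := by
    have : (2 : ℝ) ≤ d := by exact_mod_cast hd
    linarith
  have hξ := xi_pos hd Φ
  set R : ℝ := (covolX d x) ^ (κ / (d - 1 : ℝ))
  have hRnonneg : 0 ≤ R := Real.rpow_nonneg (covolSet_nonneg d _) _
  rcases hRnonneg.eq_or_lt' with hR0 | hR0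
  · rw [hR0] at hlt
    have := shortest_le_one hd0 (aSL d t ht • x)
    simp only [mul_zero, Real.exp_zero, mul_one] at hlt
    linarith
  have hcov := hcovering Φ h hh S' hS' (R / xi Φ) (div_pos hR0 hξ) hρ
  rw [mul_assoc c, div_mul_cancel₀ _ hξ.ne'] at hcov
  refine hcov ⟨ht, ?_⟩
  rintro ⟨_, ⟨y, hy, rfl⟩, v, hv, hsv⟩
  have hvx : v ∈ stabSet d x :=
    mem_stabSet_of_mem_DeltaX ((AddSubgroup.closure_le _).2 hΦ.1 hv)
  refine hlt.not_ge ((shortest_aSL_smul_le hd0 (C := (1 - R / xi Φ) * ((d - 1 : ℝ) / 2) * xi Φ)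
    (fun i => ?_) hvx hsv ht).trans ?_)
  · exact mul_le_mul_of_nonneg_left (coord_le_xi_of_mem_convexHull Φ hy i)
      (mul_nonneg (sub_nonneg.2 hρ.le) hn)
  · refine (mul_le_mul_of_nonneg_left hΦ.2 (Real.exp_pos _).le).trans_eq ?_
    rw [mul_left_comm, ← Real.exp_add]
    congr 2
    field_simp
    ring
end
end
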